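/- Let R be a commutative ring, let φ : R^m → R^n be an R-linear map, let d ≥ 1, and let r ≥ 1. Let Σ be the set of minimal elements, with respect to the partial order on Young diagrams, among the shapes of the monomials generating the monomial ideal I_r(S^d(Y)), where Y is a diagonal matrix of indeterminates of the same format as φ. Then I_r(S^d(φ)) ⊆ Σ_{σ ∈ Σ} I^{(σ)}(φ). -/

import Mathlib

noncomputable section

/-- `I_t(A)`: the ideal of `R` generated by the `t × t` minors of the matrix `A`. -/
def minorsIdeal {R : Type*} [CommRing R] (t : ℕ) {N M : Type*} (A : Matrix N M R) : Ideal R :=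
  Ideal.span {x : R | ∃ (r : Fin t → N) (c : Fin t → M), x = (A.submatrix r c).det}

/-- The matrix (in the standard bases of monomials) of the `d`-th symmetric power
`S^d(φ) : S^d(R^m) → S^d(R^n)` of the linear map `φ : R^m → R^n` given by the
`n × m` matrix `A`: the `(μ, ν)` entry is the coefficient of the monomial `x^μ` in
`Π_{j ∈ ν} φ(x_j)`, computed in the symmetric algebra `R[x_1, …, x_n]` of `R^n`. -/
def symPowMatrix {R : Type*} [CommRing R] {m n : ℕ} (d : ℕ) (A : Matrix (Fin n) (Fin m) R) :
    Matrix (Sym (Fin n) d) (Sym (Fin m) d) R := fun μ ν =>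
  MvPolynomial.coeff (Multiset.toFinsupp (μ : Multiset (Fin n)))
    (((ν : Multiset (Fin m)).map fun j =>
        ∑ i : Fin n, MvPolynomial.C (A i j) * MvPolynomial.X i).prod)

/-- A Young diagram `σ = (s_1, …, s_u)`, recorded as the multiset of its (positive) parts. -/
def IsYoungDiagram (σ : Multiset ℕ) : Prop := ∀ s ∈ σ, 0 < s

/-- `γ_j(σ) = Σ_i max (0, s_i - j + 1)` (written with truncated subtraction). -/
def youngGamma (σ : Multiset ℕ) (j : ℕ) : ℕ := (σ.map fun s => s + 1 - j).sum

/-- The partial order on Young diagrams: `σ ≤ τ` iff `γ_j σ ≤ γ_j τ` for all `j ≥ 1`. -/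
def YoungLE (σ τ : Multiset ℕ) : Prop := ∀ j, 1 ≤ j → youngGamma σ j ≤ youngGamma τ j

/-- `I^σ(A) = Π_i I_{s_i}(A)`. -/
def prodMinorsIdeal {R : Type*} [CommRing R] {N M : Type*} (A : Matrix N M R)
    (σ : Multiset ℕ) : Ideal R := (σ.map fun s => minorsIdeal s A).prod

/-- The shape of the monomial with exponent vector `e`: writing the monomial `f` as
`f = f_1 ⋯ f_u` with each `f_i` squarefree and `f_{i+1} ∣ f_i`, the shape is
`(deg f_1, …, deg f_u)`, where `deg f_i = #{j | e j ≥ i}`. -/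
def monomialShape {k : ℕ} (e : Fin k →₀ ℕ) : Multiset ℕ :=
  Multiset.filter (fun c => 0 < c)
    ((Multiset.range (e.sum fun _ v => v)).map fun i =>
      (Finset.univ.filter fun j => i + 1 ≤ e j).card)

/-- `I^{(σ)}(A) = Σ_{τ ≥ σ} I^τ(A)`, the sum over all Young diagrams `τ ≥ σ`. -/
def sumProdMinorsIdeal {R : Type*} [CommRing R] {N M : Type*} (A : Matrix N M R)
    (σ : Multiset ℕ) : Ideal R :=
  ⨆ (τ : Multiset ℕ) (_ : IsYoungDiagram τ ∧ YoungLE σ τ), prodMinorsIdeal A τ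

/-- The `n × m` diagonal matrix whose diagonal entries are independent indeterminates
`Y_1, …, Y_{min n m}` over `ℤ` (and whose other entries are zero). -/
def diagIndetMatrix (n m : ℕ) : Matrix (Fin n) (Fin m) (MvPolynomial (Fin (min n m)) ℤ) :=
  fun i j => if h : (i : ℕ) = (j : ℕ) then
      MvPolynomial.X ⟨(i : ℕ), lt_min i.isLt (h ▸ j.isLt)⟩
    else 0

/-- The set of shapes of the monomials lying in the monomial ideal `I_r(S^d(Y))`,
where `Y` is an `n × m` diagonal matrix of indeterminates over `ℤ`. -/
def shapesOfSymPowMinors (n m d r : ℕ) : Set (Multiset ℕ) :=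
  {σ | ∃ e : Fin (min n m) →₀ ℕ,
      MvPolynomial.monomial e (1 : ℤ) ∈ minorsIdeal r (symPowMatrix d (diagIndetMatrix n m)) ∧
      σ = monomialShape e}

/-- `Σ`: the set of minimal elements, with respect to the partial order on Young diagrams,
among the shapes of the monomials generating the monomial ideal `I_r(S^d(Y))`. -/
def minimalShapes (n m d r : ℕ) : Set (Multiset ℕ) :=
  {σ ∈ shapesOfSymPowMinors n m d r |
    ∀ τ ∈ shapesOfSymPowMinors n m d r, YoungLE τ σ → τ = σ}

theorem AlternatingMap.mul_mem_span_exchange {A M ι₁ ι₂ κ : Type*} [CommRing A] [AddCommGroup M]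
    [Module A M] [Fintype ι₁] [Fintype ι₂] [DecidableEq ι₁] [DecidableEq ι₂] [Fintype κ]
    (e : Module.Basis κ A M) (hκ : Fintype.card κ < Fintype.card ι₁ + Fintype.card ι₂)
    (F : M [⋀^ι₁]→ₗ[A] A) (G : M [⋀^ι₂]→ₗ[A] A) (v : ι₁ ⊕ ι₂ → M) :
    F (fun x => v (.inl x)) * G (fun y => v (.inr y)) ∈ Submodule.span ℤ
      {z | ∃ σ : Equiv.Perm (ι₁ ⊕ ι₂), (∃ x y, σ (.inl x) = .inr y) ∧
        z = F (fun x => v (σ (.inl x))) * G (fun y => v (σ (.inr y)))} := by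
  have hzero : F.domCoprod G = 0 := by
    refine e.ext_alternating fun w hw => ?_
    have := Fintype.card_le_of_injective w hw
    rw [Fintype.card_sum] at this
    omega
  have hsum : ∑ σ : Equiv.Perm.ModSumCongr ι₁ ι₂,
      LinearMap.mul' A A (AlternatingMap.domCoprod.summand F G σ v) = 0 := by
    have := congrArg (LinearMap.mul' A A) (DFunLike.congr_fun hzero v)
    simpa [AlternatingMap.domCoprod_apply, sum_apply] using this
  have hmk (σ : Equiv.Perm (ι₁ ⊕ ι₂)) :
      LinearMap.mul' A A (AlternatingMap.domCoprod.summand F G (Quotient.mk'' σ) v) =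
        ((Equiv.Perm.sign σ : ℤˣ) : ℤ) •
          (F (fun x => v (σ (.inl x))) * G (fun y => v (σ (.inr y)))) := by
    rw [AlternatingMap.domCoprod.summand_mk'']
    rw [_root_.smul_apply, Units.smul_def, map_zsmul]
    simp [MultilinearMap.domCoprod_apply]
  let q₁ : Equiv.Perm.ModSumCongr ι₁ ι₂ := Quotient.mk'' 1
  rw [← Finset.add_sum_erase _ _ (Finset.mem_univ q₁), hmk] at hsum
  simp only [Equiv.Perm.sign_one, Units.val_one, one_smul, Equiv.Perm.one_apply] at hsum
  rw [eq_neg_of_add_eq_zero_left hsum]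
  refine Submodule.neg_mem _ (Submodule.sum_mem _ fun q hq => ?_)
  induction q using Quotient.inductionOn' with | _ σ
  rw [hmk]
  refine Submodule.smul_mem _ _ (Submodule.subset_span ⟨σ, ?_, rfl⟩)
  by_contra! hσ
  refine (Finset.ne_of_mem_erase hq) (Quotient.sound' (QuotientGroup.leftRel_apply.2 ?_))
  rw [mul_one]
  refine inv_mem (Equiv.Perm.mem_sumCongrHom_range_of_perm_mapsTo_inl ?_)
  rintro _ ⟨x, rfl⟩
  rcases h : σ (.inl x) with x' | y
  · exact ⟨x', rfl⟩
  · exact absurd h (hσ x y)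

/-- Fixing some of the arguments of an alternating map. -/
def AlternatingMap.fixArguments {A M N ι : Type*} [CommRing A] [AddCommGroup M] [Module A M]
    [AddCommGroup N] [Module A N] (F : M [⋀^ι]→ₗ[A] N) (P : ι → Prop) [DecidablePred P]
    (z : ι → M) : M [⋀^{i // P i}]→ₗ[A] N where
  __ := (F : MultilinearMap A (fun _ : ι => M) N).domDomRestrict P fun i => z i
  map_eq_zero_of_eq' v i j hv hij := by
    refine F.map_eq_zero_of_eq _ (i := i) (j := j) ?_ fun h => hij (Subtype.ext h)
    simpa [i.2, j.2] using hv

theorem AlternatingMap.fixArguments_apply {A M N ι : Type*} [CommRing A] [AddCommGroup M]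
    [Module A M] [AddCommGroup N] [Module A N] (F : M [⋀^ι]→ₗ[A] N) (P : ι → Prop)
    [DecidablePred P] (z : ι → M) (v : {i // P i} → M) :
    F.fixArguments P z v = F fun i => if h : P i then v ⟨i, h⟩ else z i := rfl

/-- The maximal minor of `Z` on the columns `a 0, …, a (n - 1)`. -/
def bracket {A L : Type*} [CommRing A] {n : ℕ} (Z : Matrix (Fin n) L A) (a : Fin n → L) : A :=
  (Z.submatrix id a).det

theorem bracket_eq_detRowAlternating {A L : Type*} [CommRing A] {n : ℕ}
    (Z : Matrix (Fin n) L A) (a : Fin n → L) :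
    bracket Z a = Matrix.detRowAlternating fun i => Z.transpose (a i) :=
  (Matrix.det_transpose _).symm

theorem Equiv.Perm.sum_inl_lt {ι₁ ι₂ : Type*} [Fintype ι₁] [Fintype ι₂]
    (σ : Equiv.Perm (ι₁ ⊕ ι₂)) (hσ : ∃ x y, σ (.inl x) = .inr y) (g : ι₁ ⊕ ι₂ → ℤ) (c : ℤ)
    (h₁ : ∀ x, c ≤ g (.inl x)) (h₂ : ∀ y, g (.inr y) < c) :
    ∑ x, g (σ (.inl x)) < ∑ x, g (.inl x) := by
  classical
  have key : ∑ z, (if (σ.symm z).isLeft then g z - c else 0) <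
      ∑ z, (if z.isLeft then g z - c else 0) := by
    refine Finset.sum_lt_sum (fun z _ => ?_) ?_
    · rcases z with x | y
      · have := h₁ x
        split_ifs <;> simp_all
      · have := h₂ y
        rw [Sum.isLeft_inr, if_neg Bool.false_ne_true]
        split_ifs <;> omega
    · obtain ⟨x, y, hxy⟩ := hσ
      refine ⟨.inr y, Finset.mem_univ _, ?_⟩
      have : σ.symm (.inr y) = .inl x := by rw [← hxy, Equiv.symm_apply_apply]
      simp [this, h₂ y]
  rw [← Equiv.sum_comp σ] at key
  simpa [Finset.sum_sub_distrib] using key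

theorem bracket_mul_bracket_mem_span {A L : Type*} [CommRing A] [LinearOrder L] {n : ℕ}
    (Z : Matrix (Fin n) L A) (g : L → ℤ) (hg : StrictMono g) (a b : Fin n → L)
    (ha : StrictMono a) (hb : StrictMono b) (i : Fin n) (hi : b i < a i) :
    bracket Z a * bracket Z b ∈ Submodule.span ℤ
      {z | ∃ a' b' : Fin n → L, z = bracket Z a' * bracket Z b' ∧
        ∑ x, g (a' x) < ∑ x, g (a x) ∧
        ∑ x, g (a' x) + ∑ x, g (b' x) = ∑ x, g (a x) + ∑ x, g (b x)} := by
  classical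
  let P : Fin n → Prop := fun x => i ≤ x
  let Q : Fin n → Prop := fun x => x ≤ i
  let w : {x // P x} ⊕ {x // Q x} → L := Sum.elim (fun x => a x) (fun y => b y)
  let glueA (s : {x // P x} → L) : Fin n → L := fun x => if h : P x then s ⟨x, h⟩ else a x
  let glueB (s : {x // Q x} → L) : Fin n → L := fun x => if h : Q x then s ⟨x, h⟩ else b x
  have hA (s : {x // P x} → L) : bracket Z (glueA s) =
      Matrix.detRowAlternating.fixArguments P (fun x => Z.transpose (a x))
        (fun x => Z.transpose (s x)) := by
    rw [bracket_eq_detRowAlternating, AlternatingMap.fixArguments_apply]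
    congr 1; ext x : 1
    by_cases h : P x <;> simp [glueA, h]
  have hB (s : {x // Q x} → L) : bracket Z (glueB s) =
      Matrix.detRowAlternating.fixArguments Q (fun x => Z.transpose (b x))
        (fun x => Z.transpose (s x)) := by
    rw [bracket_eq_detRowAlternating, AlternatingMap.fixArguments_apply]
    congr 1; ext x : 1
    by_cases h : Q x <;> simp [glueB, h]
  have haeq : glueA (fun x => w (.inl x)) = a := by
    ext x; by_cases h : P x <;> simp [glueA, w, h]
  have hbeq : glueB (fun x => w (.inr x)) = b := by
    ext x; by_cases h : Q x <;> simp [glueB, w, h]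
  have sumA (s : {x // P x} → L) : ∑ x, g (glueA s x) =
      ∑ x, g (s x) + ∑ x : {x // ¬ P x}, g (a x) := by
    rw [← Fintype.sum_subtype_add_sum_subtype P]
    congr 1 <;> refine Finset.sum_congr rfl fun x _ => ?_ <;> simp [glueA, x.2]
  have sumB (s : {x // Q x} → L) : ∑ x, g (glueB s x) =
      ∑ x, g (s x) + ∑ x : {x // ¬ Q x}, g (b x) := by
    rw [← Fintype.sum_subtype_add_sum_subtype Q]
    congr 1 <;> refine Finset.sum_congr rfl fun x _ => ?_ <;> simp [glueB, x.2]
  clear_value glueA glueB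
  have hcard : Fintype.card (Fin n) < Fintype.card {x // P x} + Fintype.card {x // Q x} := by
    rw [Fintype.card_subtype, Fintype.card_subtype, ← Finset.card_union_add_card_inter]
    have h1 : (Finset.univ.filter P ∪ Finset.univ.filter Q) = Finset.univ := by
      ext x; simpa [P, Q] using le_total i x
    rw [h1, Finset.card_univ]
    exact Nat.lt_add_of_pos_right (Finset.card_pos.2 ⟨i, by simp [P, Q]⟩)
  have key := AlternatingMap.mul_mem_span_exchange (Pi.basisFun A (Fin n)) hcard
    (Matrix.detRowAlternating.fixArguments P (fun x => Z.transpose (a x)))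
    (Matrix.detRowAlternating.fixArguments Q (fun x => Z.transpose (b x)))
    (fun x => Z.transpose (w x))
  rw [← hA, ← hB, haeq, hbeq] at key
  refine Submodule.span_mono ?_ key
  rintro _ ⟨σ, hσ, rfl⟩
  refine ⟨glueA fun x => w (σ (.inl x)), glueB fun x => w (σ (.inr x)), ?_, ?_, ?_⟩
  · rw [hA, hB]
  · conv_rhs => rw [← haeq]
    rw [sumA, sumA]
    gcongr 1
    exact σ.sum_inl_lt hσ (fun x => g (w x)) (g (a i)) (fun x => hg.monotone (ha.monotone x.2))
      fun y => hg ((hb.monotone y.2).trans_lt hi)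
  · conv_rhs => rw [← haeq, ← hbeq]
    rw [sumA, sumA, sumB, sumB]
    have : ∑ x, g (w (σ x)) = ∑ x, g (w x) := Equiv.sum_comp σ fun x => g (w x)
    simp only [Fintype.sum_sum_type] at this
    linarith

/-- A sequence of strictly increasing maps that is increasing in the pointwise order. -/
def IsStandard {L : Type*} [Preorder L] {u n : ℕ} (a : Fin u → Fin n → L) : Prop :=
  (∀ j, StrictMono (a j)) ∧ Monotone a

theorem bracket_comp_perm {A L : Type*} [CommRing A] {n : ℕ} (Z : Matrix (Fin n) L A)
    (a : Fin n → L) (σ : Equiv.Perm (Fin n)) :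
    bracket Z (a ∘ σ) = ((Equiv.Perm.sign σ : ℤˣ) : ℤ) • bracket Z a := by
  rw [zsmul_eq_mul]
  exact Matrix.det_permute' σ (Z.submatrix id a)

theorem bracket_eq_zero {A L : Type*} [CommRing A] {n : ℕ} (Z : Matrix (Fin n) L A)
    (a : Fin n → L) (ha : ¬ Function.Injective a) : bracket Z a = 0 := by
  rw [bracket_eq_detRowAlternating]
  exact AlternatingMap.map_eq_zero_of_not_injective _ _ fun h => ha (Function.Injective.of_comp h)

theorem exists_strictMono_prod_bracket_eq {A L : Type*} [CommRing A] [LinearOrder L] {u n : ℕ}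
    (Z : Matrix (Fin n) L A) (a : Fin u → Fin n → L) (ha : ∀ j, Function.Injective (a j)) :
    ∃ a' : Fin u → Fin n → L, (∀ j, StrictMono (a' j)) ∧
      (∀ (g : L → ℕ) j, ∑ x, g (a' j x) = ∑ x, g (a j x)) ∧
      ∃ c : ℤ, ∏ j, bracket Z (a j) = c • ∏ j, bracket Z (a' j) := by
  refine ⟨fun j => a j ∘ Tuple.sort (a j), fun j => ?_, fun g j => ?_,
    ∏ j, ((Equiv.Perm.sign (Tuple.sort (a j)) : ℤˣ) : ℤ), ?_⟩
  · exact (Tuple.monotone_sort (a j)).strictMono_of_injective ((ha j).comp (Equiv.injective _))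
  · exact Equiv.sum_comp (Tuple.sort (a j)) fun x => g (a j x)
  · simp only [bracket_comp_perm, zsmul_eq_mul, Int.cast_prod, ← Finset.prod_mul_distrib]
    refine Finset.prod_congr rfl fun j _ => ?_
    rw [← mul_assoc, ← Int.cast_mul, ← Units.val_mul, Int.units_mul_self]
    simp

theorem Finset.prod_eq_mul_mul_erase {ι M : Type*} [Fintype ι] [DecidableEq ι] [CommMonoid M]
    (f : ι → M) {i j : ι} (h : i ≠ j) :
    ∏ x, f x = f i * f j * ∏ x ∈ (Finset.univ.erase i).erase j, f x := by
  rw [← Finset.mul_prod_erase _ _ (Finset.mem_univ i),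
    ← Finset.mul_prod_erase (Finset.univ.erase i) _ (Finset.mem_erase.2 ⟨h.symm, mem_univ j⟩),
    mul_assoc]

theorem prod_bracket_mem_span_standard {A L : Type*} [CommRing A] [LinearOrder L] [Fintype L]
    {u n : ℕ} (Z : Matrix (Fin n) L A) (a : Fin u → Fin n → L) :
    ∏ j, bracket Z (a j) ∈ Submodule.span ℤ
      {z | ∃ b : Fin u → Fin n → L, IsStandard b ∧ z = ∏ j, bracket Z (b j)} := by
  let g : L → ℕ := fun x => (Finset.univ.filter (· < x)).card
  have hg : StrictMono g := fun x y hxy => Finset.card_lt_card <| by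
    refine Finset.ssubset_iff_of_subset (fun z => ?_) |>.2 ⟨x, by simpa using hxy, by simp⟩
    simpa using fun h => lt_trans h hxy
  have hgZ : StrictMono fun x => (g x : ℤ) := fun x y h => Int.ofNat_lt.2 (hg h)
  let μ : (Fin u → Fin n → L) → ℕ := fun a => ∑ j : Fin u, (u - j) * ∑ x, g (a j x)
  induction h : μ a using Nat.strong_induction_on generalizing a with | _ N ih
  by_cases hinj : ∀ j, Function.Injective (a j)
  swap
  · obtain ⟨j, hj⟩ := not_forall.1 hinj
    rw [Finset.prod_eq_zero (Finset.mem_univ j) (bracket_eq_zero Z _ hj)]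
    exact Submodule.zero_mem _
  obtain ⟨a', ha', hga', c, hc⟩ := exists_strictMono_prod_bracket_eq Z a hinj
  rw [hc]
  refine Submodule.smul_mem _ _ ?_
  replace h : μ a' = N := by simpa only [μ, hga'] using h
  by_cases hmono : Monotone a'
  · exact Submodule.subset_span ⟨a', ⟨ha', hmono⟩, rfl⟩
  obtain ⟨j, j', hjj', i, hi⟩ : ∃ j j' : Fin u, (j' : ℕ) = j + 1 ∧ ∃ i, a' j' i < a' j i := by
    cases u with
    | zero => exact absurd (fun i => i.elim0) hmono
    | succ u =>
      rw [Fin.monotone_iff_le_succ] at hmono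
      obtain ⟨j, hj⟩ := not_forall.1 hmono
      obtain ⟨i, hi⟩ := not_forall.1 hj
      exact ⟨j.castSucc, j.succ, by simp, i, not_le.1 hi⟩
  have hne : j ≠ j' := fun h => by simp [h] at hjj'
  rw [Finset.prod_eq_mul_mul_erase _ hne]
  have key := bracket_mul_bracket_mem_span Z _ hgZ _ _ (ha' j) (ha' j') i hi
  generalize bracket Z (a' j) * bracket Z (a' j') = y at key ⊢
  induction key using Submodule.span_induction with
  | zero => simp
  | add x y _ _ hx hy => rw [add_mul]; exact Submodule.add_mem _ hx hy
  | smul r x _ hx => rw [smul_mul_assoc]; exact Submodule.smul_mem _ _ hx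
  | mem x hx =>
    obtain ⟨p, q, rfl, hlt, hsum⟩ := hx
    norm_cast at hlt hsum
    let b := Function.update (Function.update a' j p) j' q
    have hbj : b j = p := by simp [b, hne]
    have hbj' : b j' = q := by simp [b]
    have hb : ∀ x ∈ (Finset.univ.erase j).erase j', b x = a' x := fun x hx => by
      simp only [Finset.mem_erase, Finset.mem_univ, and_true] at hx
      simp [b, hx.1, hx.2]
    have hprod : bracket Z p * bracket Z q *
        ∏ x ∈ (Finset.univ.erase j).erase j', bracket Z (a' x) = ∏ x, bracket Z (b x) := by
      rw [Finset.prod_eq_mul_mul_erase _ hne, hbj, hbj']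
      exact congrArg _ (Finset.prod_congr rfl fun x hx => by rw [hb x hx])
    rw [hprod]
    refine ih (μ b) ?_ b rfl
    rw [← h]
    have hsplit (f : Fin u → ℕ) := Finset.prod_eq_mul_mul_erase
      (fun x => Multiplicative.ofAdd (f x)) hne
    simp only [← ofAdd_sum, ← ofAdd_add, EmbeddingLike.apply_eq_iff_eq] at hsplit
    have hrest : ∑ x ∈ (Finset.univ.erase j).erase j', (u - (x : ℕ)) * ∑ y, g (b x y) =
        ∑ x ∈ (Finset.univ.erase j).erase j', (u - (x : ℕ)) * ∑ y, g (a' x y) :=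
      Finset.sum_congr rfl fun x hx => by rw [hb x hx]
    simp only [μ]
    rw [hsplit, hsplit, hbj, hbj', hrest]
    refine Nat.add_lt_add_right ?_ _
    obtain ⟨t, ht⟩ : ∃ t, u - (j : ℕ) = t + 1 := ⟨u - j - 1, by omega⟩
    rw [show u - (j' : ℕ) = t by omega, ht]
    nlinarith

/-- The matrix `(A | 1)`, with its columns ordered from left to right. -/
def augmentOne {A : Type*} [CommRing A] {n m : ℕ} (M : Matrix (Fin n) (Fin m) A) :
    Matrix (Fin n) (Fin m ⊕ₗ Fin n) A :=
  fun i c => Sum.elim (M i) ((1 : Matrix (Fin n) (Fin n) A) i) (ofLex c)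

theorem bracket_map {A B L : Type*} [CommRing A] [CommRing B] {n : ℕ} (f : A →+* B)
    (Z : Matrix (Fin n) L A) (a : Fin n → L) : bracket (Z.map f) a = f (bracket Z a) := by
  rw [bracket, bracket, RingHom.map_det]; rfl

theorem augmentOne_map {A B : Type*} [CommRing A] [CommRing B] {n m : ℕ} (f : A →+* B)
    (M : Matrix (Fin n) (Fin m) A) : augmentOne (M.map f) = (augmentOne M).map f := by
  ext i c
  rcases h : ofLex c with b | b <;> simp [augmentOne, h, Matrix.one_apply, apply_ite f]

theorem bracket_augmentOne_inr {A : Type*} [CommRing A] {n m : ℕ} (M : Matrix (Fin n) (Fin m) A) :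
    bracket (augmentOne M) (fun x => toLex (.inr x)) = 1 := by
  rw [bracket]; exact Matrix.det_one

theorem bracket_augmentOne_update {A : Type*} [CommRing A] {n m : ℕ}
    (M : Matrix (Fin n) (Fin m) A) (i : Fin n) (j : Fin m) :
    bracket (augmentOne M)
      (Function.update (fun x => toLex (.inr x)) i (toLex (.inl j))) = M i j := by
  have : (augmentOne M).submatrix id
      (Function.update (fun x => toLex (.inr x)) i (toLex (.inl j))) =
      (1 : Matrix (Fin n) (Fin n) A).updateCol i fun x => M x j := by
    ext x y
    by_cases h : y = i
    · simp [augmentOne, h]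
    · simp [augmentOne, h]
      rfl
  rw [bracket, this, ← Matrix.cramer_apply, Matrix.cramer_one]
  rfl

theorem exists_standard_expansion {n m : ℕ} (f : MvPolynomial (Fin n × Fin m) ℤ) :
    ∃ (u : ℕ) (l : (Fin u → Fin n → Fin m ⊕ₗ Fin n) →₀ ℤ), (∀ c ∈ l.support, IsStandard c) ∧
      f = l.sum fun c t =>
        t • ∏ j, bracket (augmentOne (Matrix.mvPolynomialX (Fin n) (Fin m) ℤ)) (c j) := by
  set Z := augmentOne (Matrix.mvPolynomialX (Fin n) (Fin m) ℤ)
  let N : Submodule ℤ (MvPolynomial (Fin n × Fin m) ℤ) := Submodule.span ℤ (Set.range (bracket Z))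
  have h1 : 1 ≤ N := Submodule.one_le.2 (Submodule.subset_span ⟨_, bracket_augmentOne_inr _⟩)
  have hN : ∃ u, f ∈ N ^ u := by
    induction f using MvPolynomial.induction_on with
    | C a =>
      refine ⟨0, ?_⟩
      rw [pow_zero]
      exact Submodule.algebraMap_mem a
    | add p q hp hq =>
      obtain ⟨u, hu⟩ := hp
      obtain ⟨v, hv⟩ := hq
      exact ⟨max u v, Submodule.add_mem _ (pow_le_pow_right' h1 (le_max_left u v) hu)
        (pow_le_pow_right' h1 (le_max_right u v) hv)⟩
    | mul_X p x hp =>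
      obtain ⟨u, hu⟩ := hp
      refine ⟨u + 1, ?_⟩
      rw [pow_succ]
      exact Submodule.mul_mem_mul hu
        (Submodule.subset_span ⟨_, bracket_augmentOne_update _ x.1 x.2⟩)
  obtain ⟨u, hu⟩ := hN
  have hspan : f ∈ Submodule.span ℤ ((fun c : Fin u → Fin n → Fin m ⊕ₗ Fin n =>
      ∏ j, bracket Z (c j)) '' {c | IsStandard c}) := by
    rw [Submodule.span_pow] at hu
    refine Submodule.span_le.2 ?_ hu
    intro x hx
    obtain ⟨g, rfl⟩ := Set.mem_pow.1 hx
    choose c hc using fun j => (g j).2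
    rw [List.prod_ofFn]
    simp only [← hc]
    refine Submodule.span_mono ?_ (prod_bracket_mem_span_standard Z c)
    rintro _ ⟨b, hb, rfl⟩
    exact ⟨b, hb, rfl⟩
  obtain ⟨l, hl, rfl⟩ := (Finsupp.mem_span_image_iff_linearCombination ℤ).1 hspan
  exact ⟨u, l, fun c hc => hl hc, rfl⟩

theorem aeval_expansion {A : Type*} [CommRing A] {n m u : ℕ} (M : Matrix (Fin n) (Fin m) A)
    (l : (Fin u → Fin n → Fin m ⊕ₗ Fin n) →₀ ℤ) :
    MvPolynomial.aeval (R := ℤ) (fun x : Fin n × Fin m => M x.1 x.2)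
        (l.sum fun c t =>
          t • ∏ j, bracket (augmentOne (Matrix.mvPolynomialX (Fin n) (Fin m) ℤ)) (c j)) =
      l.sum fun c t => t • ∏ j, bracket (augmentOne M) (c j) := by
  have hM : augmentOne M = (augmentOne (Matrix.mvPolynomialX (Fin n) (Fin m) ℤ)).map
      (MvPolynomial.aeval (R := ℤ) fun x : Fin n × Fin m => M x.1 x.2).toRingHom := by
    rw [← augmentOne_map]
    congr 1
    ext i j
    simp
  simp only [Finsupp.sum, map_sum, map_zsmul, map_prod]
  refine Finset.sum_congr rfl fun c _ => congrArg _ (Finset.prod_congr rfl fun j _ => ?_)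
  rw [hM, bracket_map]
  rfl

/-- The positions at which `a` selects a column of the left-hand block of `(M | 1)`. -/
def leftColumns {n m : ℕ} (a : Fin n → Fin m ⊕ₗ Fin n) : Finset (Fin n) :=
  Finset.univ.filter fun i => (ofLex (a i)).isLeft

theorem bracket_augmentOne_mem {A : Type*} [CommRing A] {n m : ℕ} (M : Matrix (Fin n) (Fin m) A)
    (a : Fin n → Fin m ⊕ₗ Fin n) (ha : Function.Injective a) :
    bracket (augmentOne M) a ∈
      minorsIdeal (leftColumns a).card M := by
  classical
  set s := leftColumns a with hs
  have hl : ∀ i ∈ s, ∃ b, a i = toLex (.inl b) := fun i hi => by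
    simp only [hs, leftColumns, Finset.mem_filter, Finset.mem_univ, true_and, Sum.isLeft_iff] at hi
    obtain ⟨b, hb⟩ := hi
    exact ⟨b, hb⟩
  have hr : ∀ i, ∃ b, i ∉ s → a i = toLex (.inr b) := fun i => by
    rcases h : ofLex (a i) with b | b
    · exact ⟨i, fun hi => absurd hi (by simp [hs, leftColumns, h])⟩
    · exact ⟨b, fun _ => h⟩
  choose c hc using hr
  obtain ⟨g, hg⟩ := Set.MapsTo.exists_equiv_extend_of_card_eq (α := Fin n) (β := Fin n)
    (s := {i | i ∉ s}) (t := Finset.univ) (f := c) (by simp) (fun _ _ => by simp)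
    (fun i hi j hj hij => ha (by rw [hc i hi, hc j hj, hij]))
  let τ : Equiv.Perm (Fin n) := g.trans (Equiv.subtypeUnivEquiv Finset.mem_univ)
  have hτ : ∀ i, i ∉ s → a i = toLex (.inr (τ i)) := fun i hi => by
    rw [hc i hi, ← hg i hi]; rfl
  set D := (augmentOne M).submatrix τ a with hD
  have hone : ∀ i j, j ∉ s → D i j = (1 : Matrix (Fin n) (Fin n) A) i j := fun i j hj => by
    simp [hD, hτ j hj, augmentOne, Matrix.one_apply]
  have hdet : bracket (augmentOne M) a = ((Equiv.Perm.sign τ : ℤˣ) : ℤ) * D.det := by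
    have h := Matrix.det_permute τ ((augmentOne M).submatrix id a)
    rw [show ((augmentOne M).submatrix id a).submatrix τ id = D from rfl] at h
    rw [h, ← mul_assoc, ← Int.cast_mul, ← Units.val_mul, Int.units_mul_self]
    simp [bracket]
  rw [hdet, Matrix.twoBlockTriangular_det D (· ∉ s) fun i hi j hj => by
    rw [hone i j hj, Matrix.one_apply_ne]
    rintro rfl
    exact hi hj]
  have h1 : D.toSquareBlockProp (· ∉ s) = 1 := by
    ext i j
    rw [Matrix.toSquareBlockProp_def, Matrix.of_apply, hone _ _ j.2]
    simp [Matrix.one_apply, Subtype.ext_iff]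
  rw [h1, Matrix.det_one, one_mul]
  refine Ideal.mul_mem_left _ _ (Ideal.subset_span ?_)
  let ε : {i // ¬ i ∉ s} ≃ Fin s.card :=
    (Equiv.subtypeEquivRight fun i => not_not).trans s.equivFin
  choose b hb using fun i : {i // ¬ i ∉ s} => hl i (not_not.1 i.2)
  refine ⟨fun x => τ (ε.symm x), fun x => b (ε.symm x), ?_⟩
  rw [← Matrix.det_submatrix_equiv_self ε.symm]
  congr 1
  ext x y
  simp [Matrix.toSquareBlockProp_def, hD, augmentOne, hb]

theorem symPowMatrix_map {R S : Type*} [CommRing R] [CommRing S] {m n : ℕ} (d : ℕ) (f : R →+* S)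
    (A : Matrix (Fin n) (Fin m) R) : symPowMatrix d (A.map f) = (symPowMatrix d A).map f := by
  ext μ ν
  rw [Matrix.map_apply, symPowMatrix, symPowMatrix, ← MvPolynomial.coeff_map, map_multiset_prod,
    Multiset.map_map]
  simp

theorem MvPolynomial.IsHomogeneous.eq_sum_sym {R : Type*} [CommRing R] {n d : ℕ}
    {p : MvPolynomial (Fin n) R} (hp : p.IsHomogeneous d) :
    p = ∑ μ : Sym (Fin n) d, C (coeff (Multiset.toFinsupp (μ : Multiset (Fin n))) p) *
      ((μ : Multiset (Fin n)).map X).prod := by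
  have hX (s : Multiset (Fin n)) :
      (s.map (X (R := R))).prod = monomial (Multiset.toFinsupp s) 1 := by
    induction s using Multiset.induction_on with
    | empty => simp
    | cons a s ih =>
      rw [Multiset.map_cons, Multiset.prod_cons, ih, ← Multiset.singleton_add, map_add,
        Multiset.toFinsupp_singleton, X, monomial_mul, one_mul]
  ext e
  rw [coeff_sum]
  simp only [hX, coeff_C_mul, coeff_monomial]
  by_cases he : (Finsupp.toMultiset e).card = d
  · rw [Finset.sum_eq_single ⟨Finsupp.toMultiset e, he⟩]
    · simp
    · intro μ _ hμ
      rw [if_neg, mul_zero]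
      rintro rfl
      exact hμ (Subtype.ext (by simp))
    · exact fun h => absurd (Finset.mem_univ _) h
  · rw [Finset.sum_eq_zero, hp.coeff_eq_zero]
    · rwa [Finsupp.card_toMultiset] at he
    · intro μ _
      rw [if_neg, mul_zero]
      rintro rfl
      exact he (by simp)

theorem symPowMatrix_mul {R : Type*} [CommRing R] {l m n : ℕ} (d : ℕ)
    (A : Matrix (Fin n) (Fin m) R) (B : Matrix (Fin m) (Fin l) R) :
    symPowMatrix d (A * B) = symPowMatrix d A * symPowMatrix d B := by
  ext μ ν
  let Φ : MvPolynomial (Fin m) R →ₐ[R] MvPolynomial (Fin n) R :=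
    MvPolynomial.aeval fun j => ∑ i : Fin n, MvPolynomial.C (A i j) * MvPolynomial.X i
  set p : MvPolynomial (Fin m) R := ((ν : Multiset (Fin l)).map fun j =>
    ∑ i : Fin m, MvPolynomial.C (B i j) * MvPolynomial.X i).prod with hpdef
  have hp : p.IsHomogeneous d := by
    have h (s : Multiset (Fin l)) : (s.map fun j =>
        ∑ i : Fin m, MvPolynomial.C (B i j) * MvPolynomial.X i).prod.IsHomogeneous s.card := by
      induction s using Multiset.induction_on with
      | empty => simpa using MvPolynomial.isHomogeneous_one (Fin m) R
      | cons a s ih =>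
        rw [Multiset.map_cons, Multiset.prod_cons, Multiset.card_cons, add_comm]
        exact (MvPolynomial.IsHomogeneous.sum _ _ _ fun i _ =>
          MvPolynomial.isHomogeneous_C_mul_X _ _).mul ih
    simpa using h ν
  have hΦ : ((ν : Multiset (Fin l)).map fun j => ∑ i : Fin n, MvPolynomial.C ((A * B) i j) *
      MvPolynomial.X (R := R) i).prod = Φ p := by
    rw [hpdef, map_multiset_prod, Multiset.map_map]
    congr 1
    refine Multiset.map_congr rfl fun j _ => ?_
    simp only [Function.comp_apply, map_sum, map_mul, Φ, MvPolynomial.aeval_X,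
      MvPolynomial.algHom_C, Matrix.mul_apply, Finset.sum_mul, Finset.mul_sum]
    rw [Finset.sum_comm]
    refine Finset.sum_congr rfl fun x _ => Finset.sum_congr rfl fun y _ => ?_
    simp only [MvPolynomial.algebraMap_eq]
    ring
  rw [symPowMatrix, hΦ, hp.eq_sum_sym, map_sum, MvPolynomial.coeff_sum, Matrix.mul_apply]
  refine Finset.sum_congr rfl fun e _ => ?_
  rw [map_mul, MvPolynomial.algHom_C, MvPolynomial.algebraMap_eq, MvPolynomial.coeff_C_mul,
    map_multiset_prod, Multiset.map_map, mul_comm]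
  simp [Φ, symPowMatrix, Function.comp_def, hpdef]

theorem symPowMatrix_smul {R : Type*} [CommRing R] {m n : ℕ} (d : ℕ) (t : R)
    (A : Matrix (Fin n) (Fin m) R) : symPowMatrix d (t • A) = t ^ d • symPowMatrix d A := by
  ext μ ν
  have h : (fun j => ∑ i : Fin n, MvPolynomial.C ((t • A) i j) * MvPolynomial.X i) = fun j =>
      MvPolynomial.C t * ∑ i : Fin n, MvPolynomial.C (A i j) * MvPolynomial.X i := by
    funext j
    simp [Finset.mul_sum, mul_assoc]
  rw [symPowMatrix, h, Multiset.prod_map_mul, Multiset.map_const', Multiset.prod_replicate,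
    ← MvPolynomial.C_pow, MvPolynomial.coeff_C_mul]
  simp [symPowMatrix]

theorem symPowMatrix_map_apply {R : Type*} [CommRing R] {k m n : ℕ} (d : ℕ)
    (A : Matrix (Fin n) (Fin m) R) (f : Fin k → Fin m) (p : Fin k → Fin n) (y : Fin k → R)
    (hA : ∀ i x, A i (f x) = if i = p x then y x else 0) (μ : Sym (Fin n) d)
    (e : Sym (Fin k) d) :
    symPowMatrix d A μ (e.map f) =
      if μ = e.map p then ((e : Multiset (Fin k)).map y).prod else 0 := by
  have hprod (s : Multiset (Fin k)) :
      (s.map fun x => ∑ i : Fin n, MvPolynomial.C (A i (f x)) * MvPolynomial.X i).prod =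
        MvPolynomial.monomial (Multiset.toFinsupp (s.map p)) (s.map y).prod := by
    induction s using Multiset.induction_on with
    | empty => simp
    | cons a s ih =>
      rw [Multiset.map_cons, Multiset.prod_cons, ih, Multiset.map_cons, ← Multiset.singleton_add,
        map_add, Multiset.toFinsupp_singleton, Multiset.map_cons, Multiset.prod_cons,
        ← MvPolynomial.monomial_mul]
      congr 1
      simp [hA, apply_ite MvPolynomial.C, ite_mul, MvPolynomial.C_mul_X_eq_monomial]
  rw [symPowMatrix, Sym.coe_map, Multiset.map_map]
  simp only [Function.comp_def, hprod, MvPolynomial.coeff_monomial]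
  refine if_congr ?_ rfl rfl
  rw [Multiset.toFinsupp.injective.eq_iff, ← Sym.coe_map, Sym.coe_inj, eq_comm]

theorem symPowMatrix_diagonal {R : Type*} [CommRing R] {n : ℕ} (d : ℕ) (y : Fin n → R) :
    symPowMatrix d (Matrix.diagonal y) =
      Matrix.diagonal fun e : Sym (Fin n) d => ((e : Multiset (Fin n)).map y).prod := by
  ext μ e
  have := symPowMatrix_map_apply d (Matrix.diagonal y) id id y
    (fun i x => by simp only [Matrix.diagonal_apply, id]; split_ifs with h <;> simp [h]) μ e
  rw [Sym.map_id] at this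
  rw [this, Matrix.diagonal_apply]
  split_ifs with h <;> simp [h]

theorem Matrix.det_submatrix_mul_diagonal_mul_mem {R N M I : Type*} [CommRing R] [Fintype I]
    [DecidableEq I] {r : ℕ} (J : Ideal R) (A : Matrix N I R) (y : I → R) (B : Matrix I M R)
    (hJ : ∀ e : Fin r → I, Function.Injective e → ∏ a, y (e a) ∈ J) (ρ : Fin r → N)
    (κ : Fin r → M) : ((A * diagonal y * B).submatrix ρ κ).det ∈ J := by
  classical
  have h : (A * diagonal y * B).submatrix ρ κ =
      fun a => ∑ x : I, (A (ρ a) x * y x) • fun b => B x (κ b) := by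
    ext a b
    rw [submatrix_apply, Matrix.mul_apply]
    simp [Finset.sum_apply, Matrix.mul_diagonal]
  have hdet : ((A * diagonal y * B).submatrix ρ κ).det = detRowAlternating.toMultilinearMap
      fun a => ∑ x : I, (A (ρ a) x * y x) • fun b => B x (κ b) := by
    rw [h]; rfl
  rw [hdet, MultilinearMap.map_sum]
  refine Ideal.sum_mem _ fun e _ => ?_
  rw [MultilinearMap.map_smul_univ, smul_eq_mul]
  by_cases he : Function.Injective e
  · rw [Finset.prod_mul_distrib]
    exact Ideal.mul_mem_right _ _ (Ideal.mul_mem_left _ _ (hJ e he))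
  · rw [AlternatingMap.coe_multilinearMap, AlternatingMap.map_eq_zero_of_not_injective, mul_zero]
    · exact zero_mem _
    · exact fun h => he fun i j hij => h (by simp [hij])

/-- The diagonal entries of the square diagonal matrix with the indeterminates of
`diagIndetMatrix n m` followed by zeros. -/
def diagEntry (n m : ℕ) (i : Fin n) : MvPolynomial (Fin (min n m)) ℤ :=
  if h : (i : ℕ) < min n m then MvPolynomial.X ⟨i, h⟩ else 0

theorem prod_diagEntry_mem {n m d r : ℕ} (e : Fin r → Sym (Fin n) d)
    (he : Function.Injective e) :
    ∏ a, ((e a : Multiset (Fin n)).map (diagEntry n m)).prod ∈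
      minorsIdeal r (symPowMatrix d (diagIndetMatrix n m)) := by
  by_cases hlt : ∀ a, ∀ i ∈ e a, (i : ℕ) < min n m
  swap
  · push Not at hlt
    obtain ⟨a, i, hi, hle⟩ := hlt
    rw [Finset.prod_eq_zero (Finset.mem_univ a)]
    · exact zero_mem _
    · exact Multiset.prod_eq_zero (Multiset.mem_map.2 ⟨i, hi, by simp [diagEntry, not_lt.2 hle]⟩)
  let p : Fin (min n m) → Fin n := Fin.castLE (min_le_left _ _)
  let q : Fin (min n m) → Fin m := Fin.castLE (min_le_right _ _)
  have hex : ∀ a, ∃ e' : Sym (Fin (min n m)) d, e'.map p = e a := fun a => by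
    obtain ⟨s, hs⟩ : ∃ s : Multiset (Fin (min n m)), s.map p = e a :=
      ⟨(e a : Multiset (Fin n)).pmap (fun (i : Fin n) h => (⟨i, h⟩ : Fin (min n m)))
        (fun i hi => hlt a i (Sym.mem_coe.1 hi)), by
        rw [Multiset.map_pmap]
        simp [p, Multiset.pmap_eq_map]⟩
    exact ⟨⟨s, by rw [← (e a).2, ← Multiset.card_map p s, hs]; rfl⟩, Subtype.ext hs⟩
  choose e' he' using hex
  refine Ideal.subset_span ⟨e, fun a => (e' a).map q, ?_⟩
  have hD := symPowMatrix_map_apply d (diagIndetMatrix n m) q p MvPolynomial.X (fun i x => by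
    simp only [diagIndetMatrix, Fin.ext_iff, p, q, Fin.val_castLE]
    split_ifs with h
    · congr 1; exact Fin.ext h
    · rfl)
  have : (symPowMatrix d (diagIndetMatrix n m)).submatrix e (fun a => (e' a).map q) =
      Matrix.diagonal fun a => ((e a : Multiset (Fin n)).map (diagEntry n m)).prod := by
    refine Matrix.ext fun a b => ?_
    rw [Matrix.submatrix_apply, hD, he', Matrix.diagonal_apply]
    by_cases hab : a = b
    · subst hab
      simp only [if_true]
      rw [← he' a, Sym.coe_map, Multiset.map_map]
      refine congrArg Multiset.prod (Multiset.map_congr rfl fun x _ => ?_)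
      rw [Function.comp_apply, diagEntry, dif_pos (show (p x : ℕ) < min n m from x.2)]
      rfl
    · rw [if_neg hab, if_neg fun h => hab (he h)]
  rw [this, Matrix.det_diagonal]

theorem youngGamma_filter (σ : Multiset ℕ) {j : ℕ} (hj : 1 ≤ j) :
    youngGamma (σ.filter fun c => 0 < c) j = youngGamma σ j := by
  induction σ using Multiset.induction_on with
  | empty => simp
  | cons a σ ih =>
    by_cases ha : 0 < a
    · rw [Multiset.filter_cons_of_pos _ ha]
      simpa [youngGamma] using ih
    · rw [Multiset.filter_cons_of_neg _ ha, ih]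
      simp only [youngGamma, Multiset.map_cons, Multiset.sum_cons]
      omega

theorem youngGamma_monomialShape {k : ℕ} (e : Fin k →₀ ℕ) {j : ℕ} (hj : 1 ≤ j) :
    youngGamma (monomialShape e) j = ∑ i ∈ Finset.range (e.sum fun _ v => v),
      ((Finset.univ.filter fun x => i + 1 ≤ e x).card + 1 - j) := by
  rw [monomialShape, youngGamma_filter _ hj, youngGamma, Multiset.map_map]
  rfl

theorem sum_range_card_filter {k : ℕ} (e : Fin k →₀ ℕ) (T : Finset (Fin k)) :
    ∑ i ∈ Finset.range (e.sum fun _ v => v), (T.filter fun x => i + 1 ≤ e x).card =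
      ∑ x ∈ T, e x := by
  simp only [Finset.card_filter]
  rw [Finset.sum_comm]
  refine Finset.sum_congr rfl fun x _ => ?_
  have hx : e x ≤ e.sum fun _ v => v := by
    rw [Finsupp.sum_fintype _ _ fun _ => rfl]
    exact Finset.single_le_sum (f := fun x => e x) (fun _ _ => Nat.zero_le _) (Finset.mem_univ x)
  rw [← Finset.card_filter]
  have : (Finset.range (e.sum fun _ v => v)).filter (fun i => i + 1 ≤ e x) =
      Finset.range (e x) := by
    ext i
    simp only [Finset.mem_filter, Finset.mem_range]
    omega
  rw [this, Finset.card_range]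

theorem youngGamma_monomialShape_le {k : ℕ} (e : Fin k →₀ ℕ) {j : ℕ} (T : Finset (Fin k))
    (hT : T.card + 1 ≤ j) : youngGamma (monomialShape e) j ≤ ∑ x ∈ Tᶜ, e x := by
  rw [youngGamma_monomialShape e (by omega), ← sum_range_card_filter]
  refine Finset.sum_le_sum fun i _ => ?_
  have : (Finset.univ.filter fun x => i + 1 ≤ e x) ⊆ T ∪ Tᶜ.filter fun x => i + 1 ≤ e x := by
    intro x
    simp only [Finset.mem_filter, Finset.mem_union, Finset.mem_compl]
    tauto
  have := (Finset.card_le_card this).trans (Finset.card_union_le _ _)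
  omega

theorem exists_sum_compl_le_youngGamma {k : ℕ} (e : Fin k →₀ ℕ) {j : ℕ} (hj : 1 ≤ j) :
    ∃ T : Finset (Fin k), T.card + 1 ≤ j ∧ ∑ x ∈ Tᶜ, e x ≤ youngGamma (monomialShape e) j := by
  obtain ⟨T, hT, hmin⟩ := Finset.exists_min_image
    ((Finset.univ : Finset (Finset (Fin k))).filter fun T => T.card + 1 ≤ j)
    (fun T => ∑ x ∈ Tᶜ, e x) ⟨∅, by simpa using Nat.pos_of_ne_zero (by omega)⟩
  simp only [Finset.mem_filter, Finset.mem_univ, true_and] at hT hmin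
  have htot (T : Finset (Fin k)) := Finset.sum_add_sum_compl T fun x => e x
  refine ⟨T, hT, ?_⟩
  rw [youngGamma_monomialShape e hj, ← sum_range_card_filter]
  refine Finset.sum_le_sum fun i _ => ?_
  rcases (Tᶜ.filter fun x => i + 1 ≤ e x).eq_empty_or_nonempty with h0 | ⟨y, hy⟩
  · rw [h0]; simp
  simp only [Finset.mem_filter, Finset.mem_compl] at hy
  have hcard : T.card + 1 = j := by
    by_contra hne
    have h1 := hmin (insert y T) (by rw [Finset.card_insert_of_notMem hy.1]; omega)
    have h2 := Finset.sum_insert (f := fun x => e x) hy.1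
    have := htot T
    have := htot (insert y T)
    omega
  have hall : ∀ x ∈ T, i + 1 ≤ e x := fun x hx => by
    have hyx : y ∉ T.erase x := fun h => hy.1 (Finset.mem_of_mem_erase h)
    have h1 := hmin (insert y (T.erase x)) (by
      rw [Finset.card_insert_of_notMem hyx, Finset.card_erase_add_one hx]; omega)
    have h2 := Finset.sum_insert (f := fun x => e x) hyx
    have h3 := Finset.add_sum_erase T (fun x => e x) hx
    have := htot T
    have := htot (insert y (T.erase x))
    omega
  have hsub : T ∪ Tᶜ.filter (fun x => i + 1 ≤ e x) ⊆
      Finset.univ.filter fun x => i + 1 ≤ e x := by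
    intro x
    simp only [Finset.mem_filter, Finset.mem_union, Finset.mem_compl, Finset.mem_univ, true_and]
    rintro (h | h)
    exacts [hall x h, h.2]
  have := Finset.card_le_card hsub
  rw [Finset.card_union_of_disjoint] at this
  · omega
  · rw [Finset.disjoint_left]
    intro x hx hx'
    exact (Finset.mem_compl.1 (Finset.mem_filter.1 hx').1) hx

theorem monomialShape_mono {k : ℕ} {e e' : Fin k →₀ ℕ} (h : e ≤ e') :
    YoungLE (monomialShape e) (monomialShape e') := fun j hj => by
  obtain ⟨T, hT, hle⟩ := exists_sum_compl_le_youngGamma e' hj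
  exact (youngGamma_monomialShape_le e T hT).trans
    ((Finset.sum_le_sum fun x _ => h x).trans hle)

theorem youngLE_monomialShape_sum {k : ℕ} {ι : Type*} [Fintype ι] (E : ι → Finset (Fin k)) :
    YoungLE (Finset.univ.val.map fun l => (E l).card)
      (monomialShape (∑ l, ∑ x ∈ E l, Finsupp.single x 1)) := fun j hj => by
  classical
  obtain ⟨T, hT, hle⟩ := exists_sum_compl_le_youngGamma (∑ l, ∑ x ∈ E l, Finsupp.single x 1) hj
  refine le_trans ?_ hle
  simp only [Finsupp.coe_finsetSum, Finset.sum_apply, Finsupp.single_apply]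
  rw [Finset.sum_comm, youngGamma, Multiset.map_map]
  refine Finset.sum_le_sum fun l _ => ?_
  rw [Finset.sum_comm]
  simp only [Finset.sum_ite_eq, Function.comp_apply]
  rw [← Finset.card_filter]
  have : E l ⊆ T ∪ (E l).filter (· ∈ Tᶜ) := fun x => by
    simp only [Finset.mem_filter, Finset.mem_union, Finset.mem_compl]
    tauto
  have := (Finset.card_le_card this).trans (Finset.card_union_le _ _)
  omega

theorem monomialShape_sum_youngLE {k : ℕ} {ι : Type*} [Fintype ι] (s : ι → ℕ) :
    YoungLE (monomialShape (∑ l, ∑ x ∈ Finset.univ.filter fun x : Fin k => (x : ℕ) < s l,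
      Finsupp.single x 1))
      (Finset.univ.val.map s) := fun j hj => by
  classical
  have hT : ((Finset.univ : Finset (Fin k)).filter fun x : Fin k => (x : ℕ) + 1 < j).card + 1 ≤ j := by
    have : ((Finset.univ : Finset (Fin k)).filter fun x : Fin k => (x : ℕ) + 1 < j).card ≤
        (Finset.range (j - 1)).card :=
      Finset.card_le_card_of_injOn (fun x : Fin k => (x : ℕ)) (fun x hx => by
        simp at hx ⊢; omega) (fun x _ y _ h => Fin.ext h)
    rw [Finset.card_range] at this
    omega
  refine (youngGamma_monomialShape_le _ _ hT).trans ?_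
  simp only [Finsupp.coe_finsetSum, Finset.sum_apply, Finsupp.single_apply]
  rw [Finset.sum_comm, youngGamma, Multiset.map_map]
  refine Finset.sum_le_sum fun l _ => ?_
  rw [Finset.sum_comm]
  simp only [Finset.sum_ite_eq, Function.comp_apply]
  rw [← Finset.card_filter]
  have : (((Finset.univ : Finset (Fin k)).filter fun x : Fin k => (x : ℕ) < s l).filter fun x =>
      x ∈ ((Finset.univ : Finset (Fin k)).filter fun x : Fin k => (x : ℕ) + 1 < j)ᶜ).card ≤
        (Finset.Ico (j - 1) (s l)).card :=
    Finset.card_le_card_of_injOn (fun x : Fin k => (x : ℕ)) (fun x hx => by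
      simp at hx ⊢; omega) (fun x _ y _ h => Fin.ext h)
  rw [Nat.card_Ico] at this
  omega

theorem YoungLE.trans {σ τ υ : Multiset ℕ} (h : YoungLE σ τ) (h' : YoungLE τ υ) : YoungLE σ υ :=
  fun j hj => (h j hj).trans (h' j hj)

theorem youngGamma_add_youngGamma (σ : Multiset ℕ) (s : ℕ) :
    youngGamma σ s + youngGamma σ (s + 2) =
      2 * youngGamma σ (s + 1) + σ.count s := by
  induction σ using Multiset.induction_on with
  | empty => simp [youngGamma]
  | cons a σ ih =>
    simp only [youngGamma, Multiset.map_cons, Multiset.sum_cons, Multiset.count_cons] at ih ⊢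
    split_ifs <;> omega

theorem eq_of_youngGamma_eq {σ τ : Multiset ℕ} (hσ : IsYoungDiagram σ) (hτ : IsYoungDiagram τ)
    (h : ∀ j, 1 ≤ j → youngGamma σ j = youngGamma τ j) : σ = τ := by
  ext s
  rcases Nat.eq_zero_or_pos s with rfl | hs
  · rw [Multiset.count_eq_zero_of_notMem fun h => (hσ 0 h).ne rfl,
      Multiset.count_eq_zero_of_notMem fun h => (hτ 0 h).ne rfl]
  · have h1 := youngGamma_add_youngGamma σ s
    have h2 := youngGamma_add_youngGamma τ s
    have := h s hs
    have := h (s + 1) (by omega)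
    have := h (s + 2) (by omega)
    omega

theorem isYoungDiagram_monomialShape {k : ℕ} (e : Fin k →₀ ℕ) :
    IsYoungDiagram (monomialShape e) := fun _ hs => (Multiset.mem_filter.1 hs).2

theorem youngGamma_monomialShape_eq_zero {k : ℕ} (e : Fin k →₀ ℕ) {j : ℕ} (hj : k + 1 ≤ j) :
    youngGamma (monomialShape e) j = 0 := by
  simpa using youngGamma_monomialShape_le e Finset.univ (j := j) (by simpa using hj)

theorem exists_minimalShapes_youngLE {n m d r : ℕ} {σ : Multiset ℕ}
    (hσ : σ ∈ shapesOfSymPowMinors n m d r) :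
    ∃ τ ∈ minimalShapes n m d r, YoungLE τ σ := by
  induction hN : ∑ j ∈ Finset.range (min n m), youngGamma σ (j + 1) using
    Nat.strong_induction_on generalizing σ with | _ N ih
  by_cases hmin : ∀ τ ∈ shapesOfSymPowMinors n m d r, YoungLE τ σ → τ = σ
  · exact ⟨σ, ⟨hσ, hmin⟩, fun _ _ => le_rfl⟩
  push Not at hmin
  obtain ⟨τ, hτ, hle, hne⟩ := hmin
  have hlt : ∑ j ∈ Finset.range (min n m), youngGamma τ (j + 1) < N := by
    rw [← hN]
    refine lt_of_le_of_ne (Finset.sum_le_sum fun j _ => hle _ (by omega)) fun heq => hne ?_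
    rw [Finset.sum_eq_sum_iff_of_le fun j _ => hle _ (by omega)] at heq
    obtain ⟨e, -, rfl⟩ := hσ
    obtain ⟨e', -, rfl⟩ := hτ
    refine eq_of_youngGamma_eq (isYoungDiagram_monomialShape _) (isYoungDiagram_monomialShape _)
      fun j hj => ?_
    by_cases hjk : j ≤ min n m
    · obtain ⟨i, rfl⟩ := Nat.exists_eq_add_of_le' hj
      exact heq i (Finset.mem_range.2 hjk)
    · rw [youngGamma_monomialShape_eq_zero _ (by omega),
        youngGamma_monomialShape_eq_zero _ (by omega)]
  obtain ⟨υ, hυ, hυτ⟩ := ih _ hlt hτ rfl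
  exact ⟨υ, hυ, hυτ.trans hle⟩

/-- `d` is an upper bound for the exponents of `f`, and `c` is the coefficient of `f` at `d`. -/
def MonomialOrder.HasTopTerm {σ A : Type*} [CommSemiring A] (o : MonomialOrder σ)
    (f : MvPolynomial σ A) (d : σ →₀ ℕ) (c : A) : Prop :=
  o.toSyn (o.degree f) ≤ o.toSyn d ∧ f.coeff d = c

theorem MonomialOrder.HasTopTerm.mul {σ A : Type*} [CommSemiring A] {o : MonomialOrder σ}
    {f g : MvPolynomial σ A} {d e : σ →₀ ℕ} {a b : A} (hf : o.HasTopTerm f d a)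
    (hg : o.HasTopTerm g e b) : o.HasTopTerm (f * g) (d + e) (a * b) := by
  refine ⟨o.degree_mul_le.trans ?_, ?_⟩
  · rw [map_add, map_add]
    exact add_le_add hf.1 hg.1
  · rw [o.coeff_mul_of_add_of_degree_le hf.1 hg.1, hf.2, hg.2]

theorem MonomialOrder.hasTopTerm_one {σ A : Type*} [CommSemiring A] (o : MonomialOrder σ) :
    o.HasTopTerm (1 : MvPolynomial σ A) 0 1 := by
  refine ⟨?_, by simp⟩
  rw [← map_one MvPolynomial.C, o.degree_C]

theorem MonomialOrder.HasTopTerm.prod {σ A ι : Type*} [CommSemiring A] {o : MonomialOrder σ}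
    {f : ι → MvPolynomial σ A} {d : ι → σ →₀ ℕ} {a : ι → A} (s : Finset ι)
    (hf : ∀ i, o.HasTopTerm (f i) (d i) (a i)) :
    o.HasTopTerm (∏ i ∈ s, f i) (∑ i ∈ s, d i) (∏ i ∈ s, a i) := by
  classical
  induction s using Finset.induction_on with
  | empty => simpa using o.hasTopTerm_one
  | insert i s hi ih =>
    rw [Finset.prod_insert hi, Finset.sum_insert hi, Finset.prod_insert hi]
    exact (hf i).mul ih

theorem MonomialOrder.HasTopTerm.pow {σ A : Type*} [CommSemiring A] {o : MonomialOrder σ}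
    {f : MvPolynomial σ A} {d : σ →₀ ℕ} {a : A} (hf : o.HasTopTerm f d a) (t : ℕ) :
    o.HasTopTerm (f ^ t) (t • d) (a ^ t) := by
  simpa using HasTopTerm.prod (Finset.range t) fun _ => hf

theorem MonomialOrder.HasTopTerm.coeff_eq_zero {σ A : Type*} [CommSemiring A]
    {o : MonomialOrder σ} {f : MvPolynomial σ A} {d e : σ →₀ ℕ} {a : A}
    (hf : o.HasTopTerm f d a) (h : o.toSyn d < o.toSyn e) : f.coeff e = 0 :=
  o.coeff_eq_zero_of_lt (hf.1.trans_lt h)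

/-- The exponent of the monomial `∏ i, x_{i, p i}`. -/
def graphExponent {L : Type*} {n : ℕ} (p : Fin n → L) : (Fin n ×ₗ L) →₀ ℕ :=
  ∑ i, Finsupp.single (toLex (i, p i)) 1

theorem graphExponent_apply {L : Type*} [DecidableEq L] {n : ℕ} (p : Fin n → L) (i : Fin n)
    (l : L) : graphExponent p (toLex (i, l)) = if p i = l then 1 else 0 := by
  simp only [graphExponent, Finsupp.coe_finsetSum, Finset.sum_apply, Finsupp.single_apply,
    EmbeddingLike.apply_eq_iff_eq, Prod.mk.injEq]
  rw [Finset.sum_eq_single i]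
  · simp
  · intro j _ hj
    simp [hj]
  · simp

theorem graphExponent_lt {L : Type*} [LinearOrder L] [Fintype L] {n : ℕ} {p q : Fin n → L}
    (i : Fin n) (hlt : ∀ j < i, p j = q j) (hi : q i < p i) :
    MonomialOrder.lex.toSyn (graphExponent p) < MonomialOrder.lex.toSyn (graphExponent q) := by
  refine MonomialOrder.lex_lt_iff.2 (Finsupp.Lex.lt_iff.2 ⟨toLex (i, q i), fun x hx => ?_, ?_⟩)
  · obtain ⟨j, l⟩ := x
    change graphExponent p (toLex (j, l)) = graphExponent q (toLex (j, l))
    rw [graphExponent_apply, graphExponent_apply]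
    rcases Prod.Lex.toLex_lt_toLex.1 hx with h | ⟨h, h'⟩
    · rw [hlt j h]
    · simp only at h h'
      subst h
      rw [if_neg (h'.trans hi).ne', if_neg h'.ne']
  · change graphExponent p (toLex (i, q i)) < graphExponent q (toLex (i, q i))
    rw [graphExponent_apply, graphExponent_apply, if_neg hi.ne', if_pos rfl]
    exact Nat.one_pos

theorem graphExponent_comp_perm_lt {L : Type*} [LinearOrder L] [Fintype L] {n : ℕ}
    {a : Fin n → L} (ha : StrictMono a) {σ : Equiv.Perm (Fin n)} (hσ : σ ≠ 1) :
    MonomialOrder.lex.toSyn (graphExponent (a ∘ σ)) <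
      MonomialOrder.lex.toSyn (graphExponent a) := by
  have hne : ∃ i, σ i ≠ i := by
    by_contra! h
    exact hσ (Equiv.ext h)
  obtain ⟨i, hi, hmin⟩ := WellFounded.has_min (wellFounded_lt (α := Fin n)) {i | σ i ≠ i} hne
  have hlt : ∀ j < i, σ j = j := fun j hj => by
    by_contra h
    exact hmin j h hj
  refine graphExponent_lt i (fun j hj => congrArg a (hlt j hj)) (ha ?_)
  refine lt_of_le_of_ne (le_of_not_gt fun h => ?_) (Ne.symm hi)
  exact hi (σ.injective (hlt _ h))

/-- The matrix with entries `y i l * x_{i, l}`, where the `x_{i, l}` are indeterminates. -/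
def weightedGeneric {A L : Type*} [CommRing A] {n : ℕ} (y : Fin n → L → A) :
    Matrix (Fin n) L (MvPolynomial (Fin n ×ₗ L) A) :=
  fun i l => MvPolynomial.monomial (Finsupp.single (toLex (i, l)) 1) (y i l)

theorem MvPolynomial.prod_monomial {ι σ A : Type*} [CommSemiring A] (s : Finset ι)
    (d : ι → σ →₀ ℕ) (a : ι → A) :
    ∏ i ∈ s, monomial (d i) (a i) = monomial (∑ i ∈ s, d i) (∏ i ∈ s, a i) := by
  classical
  induction s using Finset.induction_on with
  | empty => simp
  | insert i s hi ih =>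
    rw [Finset.prod_insert hi, Finset.sum_insert hi, Finset.prod_insert hi, ih, monomial_mul]

theorem bracket_weightedGeneric {A L : Type*} [CommRing A] {n : ℕ} (y : Fin n → L → A)
    (a : Fin n → L) : bracket (weightedGeneric y) a =
      ∑ σ : Equiv.Perm (Fin n), MvPolynomial.monomial (graphExponent (a ∘ σ))
        (((Equiv.Perm.sign σ : ℤˣ) : ℤ) * ∏ i, y i (a (σ i))) := by
  rw [bracket, ← Matrix.det_transpose, Matrix.det_apply']
  refine Finset.sum_congr rfl fun σ _ => ?_
  simp only [Matrix.transpose_apply, Matrix.submatrix_apply, weightedGeneric, id,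
    MvPolynomial.prod_monomial]
  rw [← map_intCast (MvPolynomial.C (R := A) (σ := Fin n ×ₗ L)), MvPolynomial.C_mul_monomial]
  rfl

theorem hasTopTerm_bracket_weightedGeneric {A L : Type*} [CommRing A] [LinearOrder L] [Fintype L]
    {n : ℕ} (y : Fin n → L → A) {a : Fin n → L} (ha : StrictMono a) :
    MonomialOrder.lex.HasTopTerm (bracket (weightedGeneric y) a) (graphExponent a)
      (∏ i, y i (a i)) := by
  classical
  rw [bracket_weightedGeneric]
  refine ⟨MonomialOrder.degree_le_iff.2 fun c hc => ?_, ?_⟩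
  · obtain ⟨σ, -, hσ⟩ := Finset.mem_biUnion.1 (MvPolynomial.support_sum hc)
    rw [Finset.mem_singleton.1 (MvPolynomial.support_monomial_subset hσ)]
    by_cases h : σ = 1
    · rw [h]; rfl
    · exact (graphExponent_comp_perm_lt ha h).le
  · simp only [MvPolynomial.coeff_sum, MvPolynomial.coeff_monomial]
    rw [Finset.sum_eq_single 1]
    · simp
    · intro σ _ hσ
      rw [if_neg]
      intro h
      exact (graphExponent_comp_perm_lt ha hσ).ne (congrArg _ h)
    · simp

theorem List.count_ofFn {α : Type*} [DecidableEq α] {u : ℕ} (f : Fin u → α) (l : α) :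
    (List.ofFn f).count l = ∑ j, if f j = l then 1 else 0 := by
  induction u with
  | zero => simp
  | succ u ih =>
    rw [List.ofFn_succ, List.count_cons, ih, Fin.sum_univ_succ, add_comm]
    simp only [beq_iff_eq]

theorem eq_of_sum_graphExponent_eq {L : Type*} [LinearOrder L] {u n : ℕ}
    {b c : Fin u → Fin n → L} (hb : Monotone b) (hc : Monotone c)
    (h : ∑ j, graphExponent (b j) = ∑ j, graphExponent (c j)) : b = c := by
  have key : ∀ i, List.ofFn (fun j => b j i) = List.ofFn fun j => c j i := fun i => by
    refine List.Perm.eq_of_sortedLE ?_ ?_ ?_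
    · exact List.sortedLE_ofFn_iff.2 fun j j' hj => hb hj i
    · exact List.sortedLE_ofFn_iff.2 fun j j' hj => hc hj i
    · rw [List.perm_iff_count]
      intro l
      have := DFunLike.congr_fun h (toLex (i, l))
      simp only [Finsupp.coe_finsetSum, Finset.sum_apply, graphExponent_apply] at this
      rw [List.count_ofFn, List.count_ofFn, this]
  funext j i
  exact congrFun (List.ofFn_injective (key i)) j

/-- `σ` dominates the shape of some monomial of `I_r(S^d(Y))`. -/
def DominatesShape (n m d r : ℕ) (σ : Multiset ℕ) : Prop :=
  ∃ τ ∈ shapesOfSymPowMinors n m d r, YoungLE τ σ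

theorem DominatesShape.mono {n m d r : ℕ} {σ τ : Multiset ℕ} (h : DominatesShape n m d r σ)
    (hστ : YoungLE σ τ) : DominatesShape n m d r τ :=
  let ⟨υ, hυ, hυσ⟩ := h
  ⟨υ, hυ, hυσ.trans hστ⟩

/-- The ideal generated by the monomials whose shape dominates that of some monomial of
`I_r(S^d(Y))`. -/
def dominatingIdeal (n m d r : ℕ) : Ideal (MvPolynomial (Fin (min n m)) ℤ) :=
  Ideal.span ((fun e => MvPolynomial.monomial e 1) '' {e | DominatesShape n m d r (monomialShape e)})

theorem monomial_mem_dominatingIdeal_iff {n m d r : ℕ} {e : Fin (min n m) →₀ ℕ} {t : ℤ}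
    (ht : t ≠ 0) : MvPolynomial.monomial e t ∈ dominatingIdeal n m d r ↔
      DominatesShape n m d r (monomialShape e) := by
  rw [dominatingIdeal, MvPolynomial.mem_ideal_span_monomial_image]
  constructor
  · intro h
    obtain ⟨e', he', hle⟩ := h e (by simp [MvPolynomial.mem_support_iff, ht])
    exact DominatesShape.mono he' (monomialShape_mono hle)
  · intro h x hx
    rw [Finset.mem_singleton.1 (MvPolynomial.support_monomial_subset hx)]
    exact ⟨e, h, le_rfl⟩

theorem prod_map_diagEntry {n m : ℕ} (E : Finset (Fin (min n m))) :
    ∏ i ∈ E.map (Fin.castLEEmb (min_le_left n m)), diagEntry n m i =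
      MvPolynomial.monomial (∑ x ∈ E, Finsupp.single x 1) 1 := by
  have h := MvPolynomial.prod_monomial E (fun x => Finsupp.single x 1) fun _ => (1 : ℤ)
  rw [Finset.prod_const_one] at h
  rw [Finset.prod_map, ← h]
  refine Finset.prod_congr rfl fun x _ => ?_
  rw [diagEntry, dif_pos (show ((Fin.castLEEmb (min_le_left n m) x : Fin n) : ℕ) < min n m from x.2)]
  rfl

theorem exists_map_castLEEmb_eq {k n : ℕ} (h : k ≤ n) (E : Finset (Fin n))
    (hE : ∀ i ∈ E, (i : ℕ) < k) : ∃ E' : Finset (Fin k), E'.map (Fin.castLEEmb h) = E := by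
  classical
  refine ⟨Finset.univ.filter fun x => Fin.castLEEmb h x ∈ E, ?_⟩
  ext i
  simp only [Finset.mem_map, Finset.mem_filter, Finset.mem_univ, true_and]
  constructor
  · rintro ⟨x, hx, rfl⟩
    exact hx
  · intro hi
    exact ⟨⟨i, hE i hi⟩, hi, rfl⟩

theorem prod_prod_diagEntry_mem {n m d r : ℕ} {ι : Type*} [Fintype ι] (E : ι → Finset (Fin n))
    (h : DominatesShape n m d r (Finset.univ.val.map fun l => (E l).card)) :
    ∏ l, ∏ i ∈ E l, diagEntry n m i ∈ dominatingIdeal n m d r := by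
  by_cases hlt : ∀ l, ∀ i ∈ E l, (i : ℕ) < min n m
  · choose E' hE' using fun l => exists_map_castLEEmb_eq (min_le_left n m) (E l) (hlt l)
    simp only [← hE', prod_map_diagEntry, Finset.card_map] at h ⊢
    rw [MvPolynomial.prod_monomial, Finset.prod_const_one,
      monomial_mem_dominatingIdeal_iff one_ne_zero]
    exact h.mono (youngLE_monomialShape_sum E')
  · push Not at hlt
    obtain ⟨l, i, hi, hle⟩ := hlt
    rw [Finset.prod_eq_zero (Finset.mem_univ l)]
    · exact zero_mem _
    · exact Finset.prod_eq_zero hi (by simp [diagEntry, not_lt.2 hle])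

theorem prod_diagEntry_mem_dominatingIdeal {n m d r : ℕ} (e : Fin r → Sym (Fin n) d)
    (he : Function.Injective e) :
    ∏ a, ((e a : Multiset (Fin n)).map (diagEntry n m)).prod ∈ dominatingIdeal n m d r := by
  have hmem := prod_diagEntry_mem (m := m) e he
  have hs (s : Multiset (Fin n)) : (s.map (diagEntry n m)).prod = 0 ∨
      ∃ x, (s.map (diagEntry n m)).prod = MvPolynomial.monomial x 1 := by
    induction s using Multiset.induction_on with
    | empty => exact .inr ⟨0, by simp⟩
    | cons i s ih =>
      rw [Multiset.map_cons, Multiset.prod_cons]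
      by_cases hi : (i : ℕ) < min n m
      · rcases ih with h | ⟨x, h⟩
        · exact .inl (by rw [h, mul_zero])
        · refine .inr ⟨Finsupp.single ⟨i, hi⟩ 1 + x, ?_⟩
          rw [h, diagEntry, dif_pos hi, MvPolynomial.X, MvPolynomial.monomial_mul, one_mul]
      · exact .inl (by rw [diagEntry, dif_neg hi, zero_mul])
  by_cases h0 : ∃ a, ((e a : Multiset (Fin n)).map (diagEntry n m)).prod = 0
  · obtain ⟨a, ha⟩ := h0
    rw [Finset.prod_eq_zero (Finset.mem_univ a) ha]
    exact zero_mem _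
  · push Not at h0
    choose x hx using fun a => (hs (e a)).resolve_left (h0 a)
    simp only [hx] at hmem ⊢
    rw [MvPolynomial.prod_monomial, Finset.prod_const_one] at hmem ⊢
    rw [monomial_mem_dominatingIdeal_iff one_ne_zero]
    exact ⟨_, ⟨_, hmem, rfl⟩, fun _ _ => le_rfl⟩

/-- The weights of the columns of `(Y | 1)`, row by row. -/
def augEntry (n m : ℕ) (i : Fin n) (l : Fin m ⊕ₗ Fin n) : MvPolynomial (Fin (min n m)) ℤ :=
  Sum.elim (fun _ => diagEntry n m i) (fun _ => 1) (ofLex l)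

theorem prod_augEntry {n m : ℕ} (a : Fin n → Fin m ⊕ₗ Fin n) :
    ∏ i, augEntry n m i (a i) = ∏ i ∈ leftColumns a, diagEntry n m i := by
  rw [leftColumns, Finset.prod_filter]
  refine Finset.prod_congr rfl fun i _ => ?_
  rcases h : ofLex (a i) with b | b <;> simp [augEntry, h]

theorem card_leftColumns_comp_perm {n m : ℕ} (a : Fin n → Fin m ⊕ₗ Fin n)
    (σ : Equiv.Perm (Fin n)) : (leftColumns (a ∘ σ)).card = (leftColumns a).card := by
  rw [← Finset.card_map σ.toEmbedding]
  congr 1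
  ext i
  simp [leftColumns, Finset.mem_map_equiv]

theorem prod_bracket_weightedGeneric_mem {n m d r : ℕ} {ι : Type*} [Fintype ι]
    (c : ι → Fin n → Fin m ⊕ₗ Fin n)
    (h : DominatesShape n m d r (Finset.univ.val.map fun j => (leftColumns (c j)).card)) :
    ∏ j, bracket (weightedGeneric (augEntry n m)) (c j) ∈
      (dominatingIdeal n m d r).map MvPolynomial.C := by
  classical
  simp only [bracket_weightedGeneric]
  rw [Finset.prod_univ_sum]
  refine Ideal.sum_mem _ fun σ _ => ?_
  have hσ : ∀ j, ∏ i, augEntry n m i (c j (σ j i)) =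
      ∏ i ∈ leftColumns (c j ∘ σ j), diagEntry n m i := fun j => prod_augEntry (c j ∘ σ j)
  rw [MvPolynomial.prod_monomial, Finset.prod_mul_distrib, MvPolynomial.mem_map_C_iff]
  intro e
  rw [MvPolynomial.coeff_monomial]
  split_ifs
  · simp only [hσ]
    refine Ideal.mul_mem_left _ _ (prod_prod_diagEntry_mem _ ?_)
    simpa only [card_leftColumns_comp_perm] using h
  · exact zero_mem _

theorem leftColumns_of_strictMono {n m : ℕ} {a : Fin n → Fin m ⊕ₗ Fin n} (ha : StrictMono a) :
    leftColumns a = Finset.univ.filter fun i : Fin n => (i : ℕ) < (leftColumns a).card := by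
  have hdown : ∀ i j, i ≤ j → j ∈ leftColumns a → i ∈ leftColumns a := fun i j hij hj => by
    simp only [leftColumns, Finset.mem_filter, Finset.mem_univ, true_and, Sum.isLeft_iff] at hj ⊢
    obtain ⟨b, hb⟩ := hj
    rcases hi : ofLex (a i) with b' | b'
    · exact ⟨b', rfl⟩
    · have := ha.monotone hij
      rw [show a i = toLex (.inr b') from hi, show a j = toLex (.inl b) from hb] at this
      exact absurd this (by simp)
  ext i
  simp only [Finset.mem_filter, Finset.mem_univ, true_and]
  constructor
  · intro hi
    have : Finset.Iic i ⊆ leftColumns a := fun j hj => hdown j i (Finset.mem_Iic.1 hj) hi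
    have := Finset.card_le_card this
    rw [Fin.card_Iic] at this
    omega
  · intro hi
    by_contra h
    have : leftColumns a ⊆ Finset.Iio i := fun j hj => Finset.mem_Iio.2 <|
      lt_of_not_ge fun hij => h (hdown i j hij hj)
    have := Finset.card_le_card this
    rw [Fin.card_Iio] at this
    omega

theorem card_leftColumns_le {n m : ℕ} {a : Fin n → Fin m ⊕ₗ Fin n} (ha : Function.Injective a) :
    (leftColumns a).card ≤ m := by
  have hl : ∀ i : leftColumns a, ∃ b, a i = toLex (.inl b) := fun i => by
    have hi := i.2
    simp only [leftColumns, Finset.mem_filter, Finset.mem_univ, true_and, Sum.isLeft_iff] at hi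
    exact hi
  choose b hb using hl
  have : Function.Injective b := fun i j hij =>
    Subtype.ext (ha (by rw [hb, hb, hij]))
  simpa using Fintype.card_le_of_injective b this

theorem prod_augEntry_of_strictMono {n m : ℕ} {a : Fin n → Fin m ⊕ₗ Fin n} (ha : StrictMono a) :
    ∏ i, augEntry n m i (a i) = MvPolynomial.monomial (∑ x ∈ Finset.univ.filter
      fun x : Fin (min n m) => (x : ℕ) < (leftColumns a).card, Finsupp.single x 1) 1 := by
  rw [← prod_map_diagEntry, prod_augEntry]
  refine Finset.prod_congr ?_ fun _ _ => rfl
  ext i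
  rw [leftColumns_of_strictMono ha]
  have hle := card_leftColumns_le ha.injective
  simp only [Finset.mem_map, Finset.mem_filter, Finset.mem_univ, true_and]
  rw [← leftColumns_of_strictMono ha]
  constructor
  · intro hi
    exact ⟨⟨i, lt_min i.2 (hi.trans_le hle)⟩, hi, rfl⟩
  · rintro ⟨x, hx, rfl⟩
    exact hx

theorem aeval_det_symPowMatrix {A : Type*} [CommRing A] {n m d r : ℕ}
    (M : Matrix (Fin n) (Fin m) A) (ρ : Fin r → Sym (Fin n) d) (κ : Fin r → Sym (Fin m) d) :
    MvPolynomial.aeval (R := ℤ) (fun x : Fin n × Fin m => M x.1 x.2)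
        ((symPowMatrix d (Matrix.mvPolynomialX (Fin n) (Fin m) ℤ)).submatrix ρ κ).det =
      ((symPowMatrix d M).submatrix ρ κ).det := by
  have hM : (Matrix.mvPolynomialX (Fin n) (Fin m) ℤ).map
      (MvPolynomial.aeval (R := ℤ) fun x : Fin n × Fin m => M x.1 x.2).toRingHom = M := by
    ext i j
    simp
  conv_rhs => rw [← hM, symPowMatrix_map]
  exact RingHom.map_det (MvPolynomial.aeval (R := ℤ) fun x : Fin n × Fin m => M x.1 x.2).toRingHom _

theorem bracket_mul {A L : Type*} [CommRing A] {n : ℕ} (P : Matrix (Fin n) (Fin n) A)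
    (Z : Matrix (Fin n) L A) (a : Fin n → L) : bracket (P * Z) a = P.det * bracket Z a := by
  rw [bracket, bracket, ← Matrix.det_mul]
  rfl

/-- An expansion of a minor of the generic symmetric power in products of brackets of `(X | 1)`
gives one in products of brackets of an arbitrary matrix `(B | P)`, by putting `X = P⁻¹ B` and
clearing denominators. -/
theorem det_pow_mul_det_symPowMatrix {A K : Type*} [CommRing A] [Field K] {n m d r u : ℕ}
    (g : A →+* K) (hg : Function.Injective g)
    (W : Matrix (Fin n) (Fin m ⊕ₗ Fin n) A) (P : Matrix (Fin n) (Fin n) A)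
    (B : Matrix (Fin n) (Fin m) A) (hP : ∀ i j, W i (toLex (.inr j)) = P i j)
    (hB : ∀ i j, W i (toLex (.inl j)) = B i j) (hdet : P.det ≠ 0)
    (ρ : Fin r → Sym (Fin n) d) (κ : Fin r → Sym (Fin m) d)
    (l : (Fin u → Fin n → Fin m ⊕ₗ Fin n) →₀ ℤ)
    (h : ((symPowMatrix d (Matrix.mvPolynomialX (Fin n) (Fin m) ℤ)).submatrix ρ κ).det =
      l.sum fun c t =>
        t • ∏ j, bracket (augmentOne (Matrix.mvPolynomialX (Fin n) (Fin m) ℤ)) (c j)) :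
    P.det ^ u * ((symPowMatrix d (P.adjugate * B)).submatrix ρ κ).det =
      (P.det ^ d) ^ r * l.sum fun c t => t • ∏ j, bracket W (c j) := by
  set δ := g P.det with hδ
  have hδ0 : δ ≠ 0 := (map_ne_zero_iff g hg).2 hdet
  set M : Matrix (Fin n) (Fin m) K := δ⁻¹ • (P.adjugate * B).map g with hM
  have hPM : P.map g * M = B.map g := by
    rw [hM, Matrix.mul_smul, ← Matrix.map_mul, ← Matrix.mul_assoc, Matrix.mul_adjugate,
      Matrix.smul_mul, Matrix.one_mul]
    ext i j
    simp only [Matrix.smul_apply, Matrix.map_apply, smul_eq_mul, map_mul]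
    rw [← hδ, inv_mul_cancel_left₀ hδ0]
  have hW : P.map g * augmentOne M = W.map g := by
    ext i c
    obtain ⟨c, rfl⟩ := toLex.surjective c
    rcases c with j | j
    · rw [Matrix.map_apply, hB]
      exact congrFun₂ hPM i j
    · rw [Matrix.map_apply, hP]
      exact congrFun₂ (Matrix.mul_one (P.map g)) i j
  have hbr : ∀ a, δ * bracket (augmentOne M) a = g (bracket W a) := fun a => by
    rw [← bracket_map, ← hW, bracket_mul, hδ, RingHom.map_det]
    rfl
  have hf := congrArg (MvPolynomial.aeval (R := ℤ) fun x : Fin n × Fin m => M x.1 x.2) h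
  rw [aeval_det_symPowMatrix M, aeval_expansion M] at hf
  have hsym : ((symPowMatrix d M).submatrix ρ κ).det = ((δ⁻¹) ^ d) ^ r *
      g ((symPowMatrix d (P.adjugate * B)).submatrix ρ κ).det := by
    rw [hM, symPowMatrix_smul, symPowMatrix_map, RingHom.map_det]
    refine Eq.trans (Matrix.det_smul _ _) ?_
    rw [Fintype.card_fin]
    rfl
  apply hg
  rw [map_mul, map_mul, map_pow, map_pow, map_pow, ← hδ]
  have hsum : g (l.sum fun c t => t • ∏ j, bracket W (c j)) =
      δ ^ u * l.sum fun c t => t • ∏ j, bracket (augmentOne M) (c j) := by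
    simp only [Finsupp.sum, map_sum, map_zsmul, map_prod, ← hbr, Finset.prod_mul_distrib,
      Finset.prod_const, Finset.card_univ, Fintype.card_fin, Finset.mul_sum, mul_smul_comm]
  rw [hsum, ← hf, hsym, mul_left_comm _ (δ ^ u), ← mul_assoc (_ ^ r), ← mul_pow, ← mul_pow,
    mul_inv_cancel₀ hδ0, one_pow, one_pow, one_mul]

theorem det_symPowMatrix_mul_mem_map {A : Type*} [CommRing A] {n m d r : ℕ}
    (f : MvPolynomial (Fin (min n m)) ℤ →+* A) (P : Matrix (Fin n) (Fin n) A)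
    (B Q : Matrix (Fin n) (Fin m) A) (hB : ∀ i j, B i j = f (diagEntry n m i) * Q i j)
    (ρ : Fin r → Sym (Fin n) d) (κ : Fin r → Sym (Fin m) d) :
    ((symPowMatrix d (P * B)).submatrix ρ κ).det ∈ (dominatingIdeal n m d r).map f := by
  have hB' : B = Matrix.diagonal (fun i => f (diagEntry n m i)) * Q := by
    ext i j
    rw [Matrix.diagonal_mul, hB]
  rw [hB', ← Matrix.mul_assoc, symPowMatrix_mul, symPowMatrix_mul, symPowMatrix_diagonal]
  refine Matrix.det_submatrix_mul_diagonal_mul_mem _ _ _ _ (fun e he => ?_) _ _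
  have := Ideal.mem_map_of_mem f (prod_diagEntry_mem_dominatingIdeal (m := m) e he)
  simpa only [map_prod, map_multiset_prod, Multiset.map_map, Function.comp_def] using this

/-- A standard expansion of a minor of the generic symmetric power involves only products of
brackets whose shape dominates that of some monomial of `I_r(S^d(Y))`. -/
theorem dominatesShape_of_mem_support {n m d r u : ℕ}
    (ρ : Fin r → Sym (Fin n) d) (κ : Fin r → Sym (Fin m) d)
    (l : (Fin u → Fin n → Fin m ⊕ₗ Fin n) →₀ ℤ) (hl : ∀ c ∈ l.support, IsStandard c)
    (h : ((symPowMatrix d (Matrix.mvPolynomialX (Fin n) (Fin m) ℤ)).submatrix ρ κ).det =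
      l.sum fun c t =>
        t • ∏ j, bracket (augmentOne (Matrix.mvPolynomialX (Fin n) (Fin m) ℤ)) (c j)) :
    ∀ c ∈ l.support,
      DominatesShape n m d r (Finset.univ.val.map fun j => (leftColumns (c j)).card) := by
  classical
  let T := MvPolynomial (Fin n ×ₗ (Fin m ⊕ₗ Fin n)) (MvPolynomial (Fin (min n m)) ℤ)
  set W : Matrix (Fin n) (Fin m ⊕ₗ Fin n) T := weightedGeneric (augEntry n m)
  set P : Matrix (Fin n) (Fin n) T := W.submatrix id fun j => toLex (.inr j)
  set J := (dominatingIdeal n m d r).map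
    (MvPolynomial.C (σ := Fin n ×ₗ (Fin m ⊕ₗ Fin n)))
  have hinr : StrictMono fun j : Fin n => (toLex (.inr j) : Fin m ⊕ₗ Fin n) :=
    Sum.Lex.inr_strictMono
  have htopP : MonomialOrder.lex.HasTopTerm P.det (graphExponent fun j => toLex (.inr j)) 1 := by
    have := hasTopTerm_bracket_weightedGeneric (augEntry n m) hinr
    have h1 : ∏ i : Fin n, augEntry n m i (toLex (.inr i)) = 1 := by simp [augEntry]
    rwa [h1] at this
  have hdet : P.det ≠ 0 := fun h0 => by
    have := htopP.2
    rw [h0, MvPolynomial.coeff_zero] at this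
    exact zero_ne_one this
  have hmain := det_pow_mul_det_symPowMatrix _
    (FaithfulSMul.algebraMap_injective T (FractionRing T)) W P
    (W.submatrix id fun j => toLex (.inl j))
    (fun _ _ => rfl) (fun _ _ => rfl) hdet ρ κ l h
  have hleft := Ideal.mul_mem_left J (P.det ^ u)
    (det_symPowMatrix_mul_mem_map MvPolynomial.C P.adjugate
      (W.submatrix id fun j => toLex (.inl j))
      (fun i j => MvPolynomial.X (toLex (i, toLex (.inl j))))
      (fun _ _ => MvPolynomial.C_mul_X_eq_monomial.symm) ρ κ)
  rw [hmain] at hleft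
  set S := l.support.filter fun c =>
    ¬ DominatesShape n m d r (Finset.univ.val.map fun j => (leftColumns (c j)).card)
  have hbad : (P.det ^ d) ^ r * ∑ c ∈ S, l c • ∏ j, bracket W (c j) ∈ J := by
    rw [Finsupp.sum, ← Finset.sum_filter_add_sum_filter_not l.support fun c =>
      DominatesShape n m d r (Finset.univ.val.map fun j => (leftColumns (c j)).card),
      mul_add] at hleft
    refine (Ideal.add_mem_iff_right J (Ideal.mul_mem_left _ _ (Ideal.sum_mem _ fun c hc => ?_))).1
      hleft
    exact zsmul_mem (prod_bracket_weightedGeneric_mem c (Finset.mem_filter.1 hc).2) _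
  by_contra! hne
  obtain ⟨c₀, hc₀, hc₀'⟩ := hne
  obtain ⟨c, hc, hmax⟩ := S.exists_max_image
    (fun c => MonomialOrder.lex.toSyn (∑ j, graphExponent (c j)))
    ⟨c₀, Finset.mem_filter.2 ⟨hc₀, hc₀'⟩⟩
  obtain ⟨hcl, hcd⟩ := Finset.mem_filter.1 hc
  have htop : ∀ b ∈ S, MonomialOrder.lex.HasTopTerm (∏ j, bracket W (b j))
      (∑ j, graphExponent (b j)) (∏ j, ∏ i, augEntry n m i (b j i)) := fun b hb =>
    MonomialOrder.HasTopTerm.prod _ fun j =>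
      hasTopTerm_bracket_weightedGeneric _ ((hl b (Finset.mem_filter.1 hb).1).1 j)
  have hcoeff : ((P.det ^ d) ^ r * ∑ b ∈ S, l b • ∏ j, bracket W (b j)).coeff
      (r • d • graphExponent (fun j => toLex (.inr j)) + ∑ j, graphExponent (c j)) =
      l c • ∏ j, ∏ i, augEntry n m i (c j i) := by
    rw [Finset.mul_sum, MvPolynomial.coeff_sum, Finset.sum_eq_single c]
    · rw [mul_smul_comm, MvPolynomial.coeff_smul, (((htopP.pow d).pow r).mul (htop c hc)).2,
        one_pow, one_pow, one_mul]
    · intro b hb hbc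
      rw [mul_smul_comm, MvPolynomial.coeff_smul,
        (((htopP.pow d).pow r).mul (htop b hb)).coeff_eq_zero, smul_zero]
      rw [map_add, map_add]
      refine add_lt_add_right (lt_of_le_of_ne (hmax b hb) fun heq => hbc ?_) _
      exact eq_of_sum_graphExponent_eq (hl b (Finset.mem_filter.1 hb).1).2 (hl c hcl).2
        (MonomialOrder.lex.toSyn.injective heq)
    · exact fun h => absurd hc h
  have hmem := MvPolynomial.mem_map_C_iff.1 hbad
    (r • d • graphExponent (fun j => toLex (.inr j)) + ∑ j, graphExponent (c j))
  rw [hcoeff] at hmem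
  simp only [prod_augEntry_of_strictMono ((hl c hcl).1 _)] at hmem
  rw [MvPolynomial.prod_monomial, Finset.prod_const_one, MvPolynomial.smul_monomial,
    monomial_mem_dominatingIdeal_iff (by simpa using hcl)] at hmem
  exact hcd (hmem.mono (monomialShape_sum_youngLE _))

theorem minorsIdeal_zero {R N M : Type*} [CommRing R] (A : Matrix N M R) : minorsIdeal 0 A = ⊤ := by
  rw [Ideal.eq_top_iff_one]
  exact Ideal.subset_span ⟨Fin.elim0, Fin.elim0, Matrix.det_fin_zero.symm⟩

theorem prodMinorsIdeal_filter {R N M : Type*} [CommRing R] (A : Matrix N M R) (σ : Multiset ℕ) :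
    prodMinorsIdeal A (σ.filter fun c => 0 < c) = prodMinorsIdeal A σ := by
  induction σ using Multiset.induction_on with
  | empty => simp
  | cons s σ ih =>
    rcases Nat.eq_zero_or_pos s with rfl | hs
    · rw [Multiset.filter_cons_of_neg _ (lt_irrefl 0), ih, prodMinorsIdeal, prodMinorsIdeal,
        Multiset.map_cons, Multiset.prod_cons, minorsIdeal_zero, Ideal.top_mul]
    · rw [Multiset.filter_cons_of_pos (p := fun c => 0 < c) _ hs, prodMinorsIdeal,
        prodMinorsIdeal, Multiset.map_cons, Multiset.prod_cons, Multiset.map_cons,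
        Multiset.prod_cons]
      exact congrArg _ ih

theorem prodMinorsIdeal_le_of_dominatesShape {R : Type*} [CommRing R] {n m d r : ℕ}
    (φ : Matrix (Fin n) (Fin m) R) {σ : Multiset ℕ} (h : DominatesShape n m d r σ) :
    prodMinorsIdeal φ σ ≤ ⨆ σ ∈ minimalShapes n m d r, sumProdMinorsIdeal φ σ := by
  obtain ⟨υ, hυ, hυσ⟩ := h
  obtain ⟨τ, hτ, hτυ⟩ := exists_minimalShapes_youngLE hυ
  refine le_trans ?_ (le_iSup₂ τ hτ)
  rw [← prodMinorsIdeal_filter]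
  refine le_iSup₂_of_le _ ⟨fun s hs => (Multiset.mem_filter.1 hs).2, fun j hj => ?_⟩ le_rfl
  rw [youngGamma_filter _ hj]
  exact hτυ.trans hυσ j hj

/-- Let `R` be a commutative ring, `φ : R^m → R^n` a linear map, `d ≥ 1`, `r ≥ 1`, and `Σ`
the set of minimal shapes of monomials of `I_r(S^d(Y))` for a diagonal matrix `Y` of
indeterminates of the same format. Then `I_r(S^d(φ)) ⊆ Σ_{σ ∈ Σ} I^{(σ)}(φ)`. -/
theorem minors_symPow_subset_sumProdMinors {R : Type*} [CommRing R] {m n : ℕ}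
    (φ : Matrix (Fin n) (Fin m) R) (d r : ℕ) (hd : 1 ≤ d) (hr : 1 ≤ r) :
    minorsIdeal r (symPowMatrix d φ) ≤
      ⨆ σ ∈ minimalShapes n m d r, sumProdMinorsIdeal φ σ := by
  refine Ideal.span_le.2 ?_
  rintro _ ⟨ρ, κ, rfl⟩
  obtain ⟨u, l, hl, h⟩ := exists_standard_expansion
    ((symPowMatrix d (Matrix.mvPolynomialX (Fin n) (Fin m) ℤ)).submatrix ρ κ).det
  rw [SetLike.mem_coe, ← aeval_det_symPowMatrix, h, aeval_expansion]
  refine Ideal.sum_mem _ fun c hc => zsmul_mem ?_ _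
  refine prodMinorsIdeal_le_of_dominatesShape φ (dominatesShape_of_mem_support ρ κ l hl h c hc) ?_
  rw [prodMinorsIdeal, Multiset.map_map]
  exact Ideal.prod_mem_prod fun j _ =>
    bracket_augmentOne_mem φ (c j) ((hl c hc).1 j).injective
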